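/- arXiv:1009.3150 — 5 statements merged into one kernel-verified Lean document; each statement's English description precedes it below -/
import Mathlib

section
/- Let s > 0, u ≥ 0 and ε ∈ (0,1) be real numbers, and define X : ℝ → ℝ by X(t) = ((εs + u)·s·e^{st} − (s − εs)·u·e^{−ut}) / (s·((εs + u)·e^{st} + (s − εs)·e^{−ut})). Then the denominator s·((εs + u)·e^{st} + (s − εs)·e^{−ut}) is strictly positive for every t ≥ 0, X(0) = ε, and X is differentiable on [0,∞) with X′(t) = u·(1 − X(t)) + s·X(t)·(1 − X(t)) for all t ≥ 0. -/
/-- The explicit formula for the beneficial-allele frequency during a selective sweep with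
recurrent mutation solves the initial value problem
`Ẋ = u(1 − X) + s X (1 − X)`, `X(0) = ε`: the denominator is strictly positive on `[0,∞)`,
`X 0 = ε`, and `X` has the stated derivative at every `t ≥ 0`. -/
theorem sweep_ode_solution (s u ε : ℝ) (hs : 0 < s) (hu : 0 ≤ u) (hε : ε ∈ Set.Ioo (0:ℝ) 1)
    (X : ℝ → ℝ)
    (hX : ∀ t : ℝ, X t =
      ((ε * s + u) * s * Real.exp (s * t) - (s - ε * s) * u * Real.exp (-u * t)) /
        (s * ((ε * s + u) * Real.exp (s * t) + (s - ε * s) * Real.exp (-u * t)))) :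
    (∀ t : ℝ, 0 ≤ t →
      0 < s * ((ε * s + u) * Real.exp (s * t) + (s - ε * s) * Real.exp (-u * t))) ∧
    X 0 = ε ∧
    (∀ t : ℝ, 0 ≤ t → HasDerivAt X (u * (1 - X t) + s * X t * (1 - X t)) t) := by
  obtain ⟨h0, h1⟩ := hε
  have pos : ∀ t : ℝ,
      0 < (ε * s + u) * Real.exp (s * t) + (s - ε * s) * Real.exp (-u * t) := by
    intro t
    have a : 0 < ε * s + u := by positivity
    have b : 0 < s - ε * s := by nlinarith
    positivity
  refine ⟨fun t _ => mul_pos hs (pos t), ?_, ?_⟩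
  · rw [hX]
    have h : s + u ≠ 0 := by positivity
    simp only [mul_zero, Real.exp_zero, mul_one]
    rw [div_eq_iff (by
      have : ε * s + u + (s - ε * s) = s + u := by ring
      rw [this]; positivity)]
    ring
  · intro t _
    have hp := pos t
    have hE : HasDerivAt (fun t : ℝ => Real.exp (s * t)) (Real.exp (s * t) * s) t := by
      simpa using ((hasDerivAt_id t).const_mul s).exp
    have hF : HasDerivAt (fun t : ℝ => Real.exp (-u * t)) (Real.exp (-u * t) * (-u)) t := by
      simpa using ((hasDerivAt_id t).const_mul (-u)).exp
    have hN := (hE.const_mul ((ε * s + u) * s)).fun_sub (hF.const_mul ((s - ε * s) * u))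
    have hD := ((hE.const_mul (ε * s + u)).fun_add (hF.const_mul (s - ε * s))).const_mul s
    have hQ := hN.fun_div hD (mul_pos hs hp).ne'
    rw [funext hX]
    refine hQ.congr_deriv ?_
    beta_reduce
    generalize Real.exp (s * t) = E at *
    generalize Real.exp (-u * t) = F at *
    have hp' := hp.ne'
    generalize hd : (ε * s + u) * E + (s - ε * s) * F = D at *
    have hs' := hs.ne'
    field_simp
    subst hd
    ring
end

section
/- Let s > 0, u ≥ 0 and ε ∈ (0,1) be real numbers, and define X : ℝ → ℝ by X(t) = ((εs + u)·s·e^{st} − (s − εs)·u·e^{−ut}) / (s·((εs + u)·e^{st} + (s − εs)·e^{−ut})). Define T := (1/(s+u)) · log( ((1−ε)·(u + s(1−ε))) / (ε·(εs + u)) ). Then the argument of the logarithm is strictly positive and X(T) = 1 − ε. -/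
/-- At the fixation time `T = (1/(s+u)) log((1−ε)(u+s(1−ε)) / (ε(εs+u)))`, the explicit
sweep-frequency solution satisfies `X(T) = 1 − ε`, and the argument of the logarithm is
strictly positive. -/
theorem sweep_fixation_time (s u ε : ℝ) (hs : 0 < s) (hu : 0 ≤ u) (hε : ε ∈ Set.Ioo (0:ℝ) 1)
    (X : ℝ → ℝ)
    (hX : ∀ t : ℝ, X t =
      ((ε * s + u) * s * Real.exp (s * t) - (s - ε * s) * u * Real.exp (-u * t)) /
        (s * ((ε * s + u) * Real.exp (s * t) + (s - ε * s) * Real.exp (-u * t))))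
    (T : ℝ)
    (hT : T = (1 / (s + u)) *
      Real.log (((1 - ε) * (u + s * (1 - ε))) / (ε * (ε * s + u)))) :
    0 < ((1 - ε) * (u + s * (1 - ε))) / (ε * (ε * s + u)) ∧ X T = 1 - ε := by
  obtain ⟨h0, h1⟩ := hε
  have h1' : 0 < 1 - ε := by linarith
  have hA : 0 < ε * s + u := by positivity
  have hB : 0 < s - ε * s := by nlinarith
  have hR : 0 < ((1 - ε) * (u + s * (1 - ε))) / (ε * (ε * s + u)) := by positivity
  refine ⟨hR, ?_⟩
  have hsu : s + u ≠ 0 := by positivity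
  have hlog : s * T = Real.log (((1 - ε) * (u + s * (1 - ε))) / (ε * (ε * s + u))) + -u * T := by
    have : (s + u) * T = Real.log (((1 - ε) * (u + s * (1 - ε))) / (ε * (ε * s + u))) := by
      rw [hT, ← mul_assoc, mul_one_div_cancel hsu, one_mul]
    linarith
  have hE : Real.exp (s * T) =
      ((1 - ε) * (u + s * (1 - ε))) / (ε * (ε * s + u)) * Real.exp (-u * T) := by
    rw [hlog, Real.exp_add, Real.exp_log hR]
  have hF := Real.exp_pos (-u * T)
  have hG := Real.exp_pos (s * T)
  rw [hX]
  generalize Real.exp (s * T) = E at *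
  generalize Real.exp (-u * T) = F at *
  have key : (ε * (ε * s + u)) * E = (1 - ε) * (u + s * (1 - ε)) * F := by
    rw [hE]; field_simp
  rw [div_eq_iff (by positivity)]
  linear_combination s * key
end

section
/- Let s > 0, u ≥ 0 and ε ∈ (0,1) be real numbers, and define X : ℝ → ℝ by X(t) = ((εs + u)·s·e^{st} − (s − εs)·u·e^{−ut}) / (s·((εs + u)·e^{st} + (s − εs)·e^{−ut})). Then X is strictly increasing on [0,∞), X(t) ∈ (ε, 1) for all t > 0, and X(t) → 1 as t → ∞. -/
/-- The explicit sweep-frequency solution is strictly increasing on `[0,∞)`, stays in the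
interval `(ε, 1)` for every `t > 0`, and tends to `1` as `t → ∞`. -/
theorem sweep_solution_monotone (s u ε : ℝ) (hs : 0 < s) (hu : 0 ≤ u)
    (hε : ε ∈ Set.Ioo (0:ℝ) 1)
    (X : ℝ → ℝ)
    (hX : ∀ t : ℝ, X t =
      ((ε * s + u) * s * Real.exp (s * t) - (s - ε * s) * u * Real.exp (-u * t)) /
        (s * ((ε * s + u) * Real.exp (s * t) + (s - ε * s) * Real.exp (-u * t)))) :
    StrictMonoOn X (Set.Ici (0:ℝ)) ∧
    (∀ t : ℝ, 0 < t → X t ∈ Set.Ioo ε 1) ∧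
    Filter.Tendsto X Filter.atTop (nhds 1) := by
  obtain ⟨h0, h1⟩ := hε
  have hA : 0 < ε * s + u := by positivity
  have hB : 0 < s - ε * s := by nlinarith
  have hc : 0 < s + u := by positivity
  have key : ∀ t, X t = 1 - ((s - ε * s) * (s + u) / s) /
      ((ε * s + u) * Real.exp ((s + u) * t) + (s - ε * s)) := by
    intro t
    have e : Real.exp (s * t) = Real.exp ((s + u) * t) * Real.exp (-u * t) := by
      rw [← Real.exp_add]; congr 1; ring
    rw [hX, e]
    have p1 := Real.exp_pos ((s + u) * t)
    have p2 := Real.exp_pos (-u * t)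
    generalize Real.exp ((s + u) * t) = E at *
    generalize Real.exp (-u * t) = F at *
    generalize hAA : ε * s + u = A at *
    generalize hBB : s - ε * s = B at *
    have d1 : A * E + B ≠ 0 := by positivity
    have d2 : A * (E * F) + B * F ≠ 0 := by positivity
    rw [div_div, one_sub_div (by positivity), div_eq_div_iff (by positivity) (by positivity)]
    ring
  have hK : 0 < (s - ε * s) * (s + u) / s := by positivity
  have mono : StrictMono X := by
    intro a b hab
    rw [key, key]
    have : Real.exp ((s + u) * a) < Real.exp ((s + u) * b) := by gcongr
    gcongr
  have hX0 : X 0 = ε := by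
    rw [key]
    have : ε * s + u + (s - ε * s) = s + u := by ring
    simp only [mul_zero, Real.exp_zero, mul_one, this]
    field_simp
    ring
  refine ⟨mono.strictMonoOn _, fun t ht => ⟨?_, ?_⟩, ?_⟩
  · rw [← hX0]; exact mono ht
  · rw [key]
    have : 0 < ((s - ε * s) * (s + u) / s) /
      ((ε * s + u) * Real.exp ((s + u) * t) + (s - ε * s)) := by positivity
    linarith
  · rw [funext key]
    have h : Filter.Tendsto (fun t : ℝ => (ε * s + u) * Real.exp ((s + u) * t) + (s - ε * s))
        Filter.atTop Filter.atTop :=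
      Filter.tendsto_atTop_add_const_right _ _
        ((Real.tendsto_exp_atTop.comp (Filter.tendsto_id.const_mul_atTop hc)).const_mul_atTop hA)
    simpa using (h.const_div_atTop ((s - ε * s) * (s + u) / s)).const_sub 1
end

section
/- Let N ≥ 1, s ≥ 0, θ_s ≥ 0, T > 0 be real numbers and let X : ℝ → (0,1] be measurable. Define λ(t) := (1+s)/(2N·X(T−t)) and μ(t) := θ_s·(1 − X(T−t))/(2N·X(T−t)) for t ∈ [0,T], and suppose λ and μ are integrable on [0,T]; set Λ(t) := ∫₀^t λ, M(t) := ∫₀^t μ. Then λ(t)/(λ(t) + μ(t)) ≥ (1+s)/(1+s+θ_s) for every t ∈ [0,T], and consequently ∫₀^{T} λ(t)·e^{−Λ(t) − M(t)} dt ≥ ((1+s)/(1+s+θ_s))·(1 − e^{−Λ(T) − M(T)}). -/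
open MeasureTheory

lemma exp_neg_ac {f : ℝ → ℝ} {a b : ℝ} (hf : AbsolutelyContinuousOnInterval f a b)
    (h0 : ∀ x ∈ Set.uIcc a b, 0 ≤ f x) :
    AbsolutelyContinuousOnInterval (fun x => Real.exp (-(f x))) a b := by
  have key : ∀ x y : ℝ, 0 ≤ x → x ≤ y → |Real.exp (-x) - Real.exp (-y)| ≤ |x - y| := by
    intro x y hx hxy
    have h1 : Real.exp (-y) ≤ Real.exp (-x) := Real.exp_le_exp.mpr (by linarith)
    have h2 : Real.exp (-x) ≤ 1 := Real.exp_le_one_iff.mpr (by linarith)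
    have h3 : Real.exp (-y) = Real.exp (-x) * Real.exp (-(y - x)) := by
      rw [← Real.exp_add]; congr 1; ring
    have h4 := Real.add_one_le_exp (-(y - x))
    have h5 := Real.exp_pos (-x)
    rw [abs_of_nonneg (by linarith), abs_of_nonpos (by linarith), h3]
    nlinarith
  rw [absolutelyContinuousOnInterval_iff] at hf ⊢
  intro ε hε
  obtain ⟨δ, hδ, h⟩ := hf ε hε
  refine ⟨δ, hδ, fun E hE hlt => lt_of_le_of_lt (Finset.sum_le_sum fun i hi => ?_) (h E hE hlt)⟩
  have hx := h0 _ (hE.1 i hi).1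
  have hy := h0 _ (hE.1 i hi).2
  rw [Real.dist_eq, Real.dist_eq]
  rcases le_total (f (E.2 i).1) (f (E.2 i).2) with hh | hh
  · exact key _ _ hx hh
  · rw [abs_sub_comm, abs_sub_comm (f _)]
    exact key _ _ hy hh

/-- For the sweep coalescence rate `λ(t) = (1+s)/(2N X(T−t))` and mutation rate
`μ(t) = θ_s(1−X(T−t))/(2N X(T−t))` one has `λ/(λ+μ) ≥ (1+s)/(1+s+θ_s)` on `[0,T]`, and
consequently `∫₀^T λ e^{−Λ−M} ≥ ((1+s)/(1+s+θ_s)) (1 − e^{−Λ(T)−M(T)})`. -/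
theorem hard_sweep_probability_bound (N s θ T : ℝ)
    (hN : 1 ≤ N) (hs : 0 ≤ s) (hθ : 0 ≤ θ) (hT : 0 < T)
    (X : ℝ → ℝ) (hXmeas : Measurable X) (hX : ∀ t : ℝ, 0 < X t ∧ X t ≤ 1)
    (lam mu : ℝ → ℝ)
    (hlam : ∀ t ∈ Set.Icc (0:ℝ) T, lam t = (1 + s) / (2 * N * X (T - t)))
    (hmu : ∀ t ∈ Set.Icc (0:ℝ) T, mu t = θ * (1 - X (T - t)) / (2 * N * X (T - t)))
    (hlam_int : IntegrableOn lam (Set.Icc 0 T))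
    (hmu_int : IntegrableOn mu (Set.Icc 0 T))
    (Λ M : ℝ → ℝ)
    (hΛ : ∀ t : ℝ, Λ t = ∫ τ in (0:ℝ)..t, lam τ)
    (hM : ∀ t : ℝ, M t = ∫ τ in (0:ℝ)..t, mu τ) :
    (∀ t ∈ Set.Icc (0:ℝ) T, (1 + s) / (1 + s + θ) ≤ lam t / (lam t + mu t)) ∧
    ((1 + s) / (1 + s + θ)) * (1 - Real.exp (-(Λ T + M T))) ≤
      ∫ t in (0:ℝ)..T, lam t * Real.exp (-(Λ t + M t)) := by
  have hc : 0 < 1 + s + θ := by linarith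
  have hpos : ∀ t ∈ Set.Icc (0:ℝ) T, 0 < lam t ∧ 0 ≤ mu t ∧
      (1 + s) / (1 + s + θ) * (lam t + mu t) ≤ lam t := by
    intro t ht
    obtain ⟨h1, h2⟩ := hX (T - t)
    have hd : 0 < 2 * N * X (T - t) := by positivity
    rw [hlam t ht, hmu t ht]
    refine ⟨by positivity, div_nonneg (mul_nonneg hθ (by linarith)) hd.le, ?_⟩
    rw [← add_div, div_mul_div_comm, div_le_div_iff₀ (by positivity) hd]
    have : 0 ≤ (1 + s) * (2 * N * X (T - t)) * (θ * X (T - t)) := by positivity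
    nlinarith
  refine ⟨fun t ht => ?_, ?_⟩
  · obtain ⟨h1, h2, h3⟩ := hpos t ht
    rwa [le_div_iff₀ (by linarith)]
  have hu : Set.uIcc 0 T = Set.Icc 0 T := Set.uIcc_of_le hT.le
  have il : IntervalIntegrable lam volume 0 T :=
    (intervalIntegrable_iff_integrableOn_Icc_of_le hT.le).2 hlam_int
  have im : IntervalIntegrable mu volume 0 T :=
    (intervalIntegrable_iff_integrableOn_Icc_of_le hT.le).2 hmu_int
  have hΛ' : Λ = fun t => ∫ τ in (0:ℝ)..t, lam τ := funext hΛ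
  have hM' : M = fun t => ∫ τ in (0:ℝ)..t, mu τ := funext hM
  have acΛ : AbsolutelyContinuousOnInterval Λ 0 T :=
    hΛ' ▸ il.absolutelyContinuousOnInterval_intervalIntegral (by simp)
  have acM : AbsolutelyContinuousOnInterval M 0 T :=
    hM' ▸ im.absolutelyContinuousOnInterval_intervalIntegral (by simp)
  have acF : AbsolutelyContinuousOnInterval (fun t => Real.exp (-(Λ t + M t))) 0 T := by
    refine exp_neg_ac (f := fun t => Λ t + M t) (acΛ.add acM) ?_
    intro x hx
    rw [hu] at hx
    have h1 : 0 ≤ Λ x := by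
      rw [hΛ]
      exact intervalIntegral.integral_nonneg hx.1
        fun u hu => (hpos u ⟨hu.1, hu.2.trans hx.2⟩).1.le
    have h2 : 0 ≤ M x := by
      rw [hM]
      exact intervalIntegral.integral_nonneg hx.1
        fun u hu => (hpos u ⟨hu.1, hu.2.trans hx.2⟩).2.1
    exact add_nonneg h1 h2
  have hF0 : Λ 0 + M 0 = 0 := by simp [hΛ, hM]
  have hFTC := acF.integral_deriv_eq_sub
  have hcong : ∫ t in (0:ℝ)..T, deriv (fun t => Real.exp (-(Λ t + M t))) t =
      ∫ t in (0:ℝ)..T, -((lam t + mu t) * Real.exp (-(Λ t + M t))) := by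
    apply intervalIntegral.integral_congr_ae
    filter_upwards [il.ae_hasDerivAt_integral, im.ae_hasDerivAt_integral] with x h1 h2 hx
    have hx' := Set.uIoc_subset_uIcc hx
    have d1 : HasDerivAt Λ (lam x) x := hΛ' ▸ h1 hx' 0 (by simp)
    have d2 : HasDerivAt M (mu x) x := hM' ▸ h2 hx' 0 (by simp)
    have d3 : HasDerivAt (fun t => Real.exp (-(Λ t + M t)))
      (Real.exp (-(Λ x + M x)) * (-(lam x + mu x))) x := ((d1.add d2).neg).exp
    rw [d3.deriv]; ring
  rw [hcong, intervalIntegral.integral_neg, hF0, neg_zero, Real.exp_zero] at hFTC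
  have hE : 1 - Real.exp (-(Λ T + M T)) =
      ∫ t in (0:ℝ)..T, (lam t + mu t) * Real.exp (-(Λ t + M t)) := by linarith
  rw [hE, ← intervalIntegral.integral_const_mul]
  refine intervalIntegral.integral_mono_on hT.le
    (((il.add im).mul_continuousOn acF.continuousOn).const_mul _)
    (il.mul_continuousOn acF.continuousOn) ?_
  intro x hx
  rw [← mul_assoc]
  exact mul_le_mul_of_nonneg_right (hpos x hx).2.2 (Real.exp_pos _).le
end

section
/- Let n be a positive integer and θ a real number. Then ∑ n!·∏_{j=1}^{n} (θ/j)^{a_j}/(a_j!) = θ·(θ+1)·⋯·(θ+n−1), where the sum ranges over all tuples (a_1, …, a_n) of nonnegative integers with ∑_{j=1}^{n} j·a_j = n. Equivalently, for θ with θ·(θ+1)·⋯·(θ+n−1) ≠ 0, the Ewens sampling probabilities (n!/θ_{(n)})·∏_{j=1}^{n} (θ/j)^{a_j}/(a_j!) over all such tuples sum to 1, where θ_{(n)} := θ(θ+1)⋯(θ+n−1). -/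
open Finset

open Polynomial in
/-- truncated exponential series of `θ X^(j+1)/(j+1)` -/
noncomputable def ewF (n : ℕ) (θ : ℝ) (j : ℕ) : Polynomial ℝ :=
  ∑ k : Fin (n + 1), C ((θ / (j + 1)) ^ k.val / (k.val.factorial : ℝ)) * X ^ ((j + 1) * k.val)

open Polynomial in
lemma ewF_zero (n : ℕ) (θ : ℝ) (j : ℕ) : (ewF n θ j).eval 0 = 1 := by
  unfold ewF
  rw [eval_finset_sum, Fin.sum_univ_succ]
  simp

open Polynomial in
lemma ewF_deriv (n : ℕ) (θ : ℝ) (j : ℕ) :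
    ∃ Q : Polynomial ℝ, derivative (ewF n θ j) = C θ * X ^ j * ewF n θ j + X ^ n * Q := by
  refine ⟨- (C θ * X ^ j * C ((θ / (j + 1)) ^ n / (n.factorial : ℝ)) * X ^ (j * n)), ?_⟩
  have h1 : derivative (ewF n θ j) = C θ * X ^ j *
      ∑ k : Fin n, C ((θ / (j + 1)) ^ k.val / (k.val.factorial : ℝ)) * X ^ ((j + 1) * k.val) := by
    unfold ewF
    rw [Fin.sum_univ_succ, derivative_add, derivative_sum, Finset.mul_sum]
    simp only [Fin.val_zero, mul_zero, pow_zero, mul_one, derivative_C, zero_add, Fin.val_succ]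
    refine Finset.sum_congr rfl fun k _ => ?_
    rw [derivative_C_mul_X_pow]
    have e : (j + 1) * (k.val + 1) - 1 = j + (j + 1) * k.val := by
      have : (j + 1) * (k.val + 1) = j + (j + 1) * k.val + 1 := by ring
      omega
    have c : (θ / (j + 1)) ^ (k.val + 1) / ((k.val + 1).factorial : ℝ) *
        (((j + 1) * (k.val + 1) : ℕ) : ℝ) = θ * ((θ / (j + 1)) ^ k.val / (k.val.factorial : ℝ)) := by
      have hj : (j : ℝ) + 1 ≠ 0 := by positivity
      have hk : (k.val : ℝ) + 1 ≠ 0 := by positivity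
      have hf : (k.val.factorial : ℝ) ≠ 0 := by positivity
      rw [Nat.factorial_succ, pow_succ]
      push_cast
      field_simp
    rw [e, c, C_mul, pow_add]
    ring
  rw [h1]
  unfold ewF
  rw [Fin.sum_univ_castSucc]
  simp only [Fin.val_castSucc, Fin.val_last]
  ring

open Polynomial in
lemma ewP_deriv (n : ℕ) (θ : ℝ) (s : Finset ℕ) :
    ∃ Q : Polynomial ℝ, derivative (∏ j ∈ s, ewF n θ j) =
      C θ * (∑ j ∈ s, X ^ j) * (∏ j ∈ s, ewF n θ j) + X ^ n * Q := by
  classical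
  induction s using Finset.induction_on with
  | empty => exact ⟨0, by simp⟩
  | insert a s ha ih =>
    obtain ⟨Q, hQ⟩ := ih
    obtain ⟨R, hR⟩ := ewF_deriv n θ a
    refine ⟨R * (∏ j ∈ s, ewF n θ j) + ewF n θ a * Q, ?_⟩
    rw [Finset.prod_insert ha, Finset.sum_insert ha, derivative_mul, hQ, hR]
    ring

open Polynomial in
lemma ewP_rec (n : ℕ) (θ : ℝ) (m : ℕ) (hm : m < n) :
    ((m : ℝ) + 1) * (∏ j ∈ range n, ewF n θ j).coeff (m + 1) =
      (θ + m) * (∏ j ∈ range n, ewF n θ j).coeff m := by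
  obtain ⟨Q, hQ⟩ := ewP_deriv n θ (range n)
  set P := ∏ j ∈ range n, ewF n θ j
  have hg : (∑ j ∈ range n, (X : Polynomial ℝ) ^ j) * (X - 1) = X ^ n - 1 := geom_sum_mul X n
  have h : derivative P = X * derivative P + C θ * P + X ^ n * (- (C θ * P) - (X - 1) * Q) := by
    linear_combination (-(X - 1)) * hQ - C θ * P * hg
  have hc := congrArg (fun p => coeff p m) h
  simp only [coeff_add, coeff_C_mul, coeff_derivative] at hc
  rw [coeff_X_pow_mul', if_neg (by omega)] at hc
  have hx : (X * derivative P).coeff m = m * P.coeff m := by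
    cases m with
    | zero => simp
    | succ k => rw [coeff_X_mul, coeff_derivative]; push_cast; ring
  rw [hx] at hc
  linear_combination hc

open Polynomial in
lemma ewP_coeff (n : ℕ) (θ : ℝ) (m : ℕ) (hm : m ≤ n) :
    (m.factorial : ℝ) * (∏ j ∈ range n, ewF n θ j).coeff m = ∏ k ∈ range m, (θ + k) := by
  induction m with
  | zero =>
    rw [coeff_zero_eq_eval_zero, eval_prod]
    simp [ewF_zero]
  | succ m ih =>
    rw [Finset.prod_range_succ, ← ih (by omega), Nat.factorial_succ]
    have := ewP_rec n θ m (by omega)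
    push_cast
    linear_combination (m.factorial : ℝ) * this

open Polynomial in
lemma ewP_sum (n : ℕ) (θ : ℝ) :
    (∏ j ∈ range n, ewF n θ j).coeff n = ∑ a ∈ Finset.univ.filter
        (fun a : Fin n → Fin (n + 1) => ∑ j : Fin n, (j.val + 1) * (a j).val = n),
        ∏ j : Fin n, (θ / (j.val + 1)) ^ (a j).val / ((a j).val.factorial : ℝ) := by
  rw [← Fin.prod_univ_eq_prod_range]
  unfold ewF
  rw [Finset.prod_univ_sum, Fintype.piFinset_univ, finset_sum_coeff, Finset.sum_filter]
  refine Finset.sum_congr rfl fun a _ => ?_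
  rw [Finset.prod_mul_distrib, Finset.prod_pow_eq_pow_sum, ← map_prod, coeff_C_mul_X_pow]
  simp only [eq_comm]

/-- Ewens sampling formula sums to the ascending factorial: over all tuples
`(a_1, …, a_n)` of nonnegative integers with `∑ j·a_j = n` (encoded as functions
`Fin n → Fin (n+1)`, which loses no tuples since necessarily `a_j ≤ n`),
`∑ n! ∏_j (θ/j)^{a_j}/a_j! = θ(θ+1)⋯(θ+n−1)`; equivalently, when the ascending
factorial is nonzero the Ewens probabilities sum to `1`. -/
theorem ewens_sum (n : ℕ) (hn : 0 < n) (θ : ℝ) :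
    (∑ a ∈ Finset.univ.filter
        (fun a : Fin n → Fin (n + 1) => ∑ j : Fin n, (j.val + 1) * (a j).val = n),
      (n.factorial : ℝ) *
        ∏ j : Fin n, (θ / (j.val + 1)) ^ (a j).val / ((a j).val.factorial : ℝ)) =
      ∏ k ∈ Finset.range n, (θ + k) ∧
    ((∏ k ∈ Finset.range n, (θ + k)) ≠ 0 →
      (∑ a ∈ Finset.univ.filter
          (fun a : Fin n → Fin (n + 1) => ∑ j : Fin n, (j.val + 1) * (a j).val = n),
        (n.factorial : ℝ) / (∏ k ∈ Finset.range n, (θ + k)) *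
          ∏ j : Fin n, (θ / (j.val + 1)) ^ (a j).val / ((a j).val.factorial : ℝ)) = 1) := by
  have h : (n.factorial : ℝ) * _ = _ := ewP_coeff n θ n le_rfl
  rw [ewP_sum] at h
  refine ⟨by rw [← Finset.mul_sum]; exact h, fun h0 => ?_⟩
  rw [← Finset.mul_sum, div_mul_eq_mul_div, h, div_self h0]
end
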